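/- arXiv:2307.15231 — 2 statements merged into one kernel-verified Lean document; each statement's English description precedes it below -/
import Mathlib

section
/- (Böttcher–Wenzel inequality, used in the proof of Theorem 3) For any matrices A, B ∈ ℂ^{N×N}, the commutator [A,B] = AB − BA satisfies ‖[A,B]‖_F² ≤ 2 ‖A‖_F² ‖B‖_F². -/
/-- The Frobenius norm of a complex matrix: `(Σ_{i,j} |A_{ij}|²)^{1/2}`. -/
noncomputable def frobeniusNorm {N : ℕ} (A : Matrix (Fin N) (Fin N) ℂ) : ℝ :=
  Real.sqrt (∑ i, ∑ j, ‖A i j‖ ^ 2)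

open Matrix
open scoped ComplexOrder

/-- A variance bound: for nonnegative weights of total mass one, the variance of `a` is at most
`(∑ i, a i ^ 2) / 2`. Stated homogeneously in the weights. -/
theorem sum_weighted_sq_sub_sq_le {ι : Type*} [Fintype ι] (p a : ι → ℝ) (hp : ∀ i, 0 ≤ p i) :
    (∑ i, p i) * (∑ i, p i * a i ^ 2) - (∑ i, p i * a i) ^ 2
      ≤ (∑ i, p i) ^ 2 * (∑ i, a i ^ 2) / 2 := by
  classical
  rcases isEmpty_or_nonempty ι with _ | _
  · simp
  obtain ⟨i, hi⟩ := Finite.exists_max a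
  obtain ⟨j, hj⟩ := Finite.exists_min a
  have hs : 0 ≤ ∑ k, p k := Finset.sum_nonneg fun k _ => hp k
  have hquad : ∑ k, p k * a k ^ 2 ≤
      (a i + a j) * (∑ k, p k * a k) - a i * a j * ∑ k, p k := by
    rw [Finset.mul_sum, Finset.mul_sum, ← Finset.sum_sub_distrib]
    refine Finset.sum_le_sum fun k _ => ?_
    nlinarith [mul_nonneg (hp k) (mul_nonneg (sub_nonneg.2 (hi k)) (sub_nonneg.2 (hj k)))]
  have hrange : (a i - a j) ^ 2 ≤ 2 * ∑ k, a k ^ 2 := by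
    rcases eq_or_ne i j with rfl | hij
    · simpa using Finset.sum_nonneg fun k _ => sq_nonneg (a k)
    · have h := Finset.sum_le_sum_of_subset_of_nonneg (Finset.subset_univ {i, j})
        (fun k _ _ => sq_nonneg (a k))
      rw [Finset.sum_pair hij] at h
      nlinarith [sq_nonneg (a i + a j)]
  nlinarith [mul_le_mul_of_nonneg_left hquad hs,
    mul_le_mul_of_nonneg_left hrange (sq_nonneg (∑ k, p k)),
    sq_nonneg (2 * (∑ k, p k * a k) - (a i + a j) * ∑ k, p k)]

/-- The squared Frobenius norm as a trace. -/
theorem Matrix.re_trace_mul_conjTranspose {n : Type*} [Fintype n] (M : Matrix n n ℂ) :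
    (M * Mᴴ).trace.re = ∑ i, ∑ j, ‖M i j‖ ^ 2 := by
  simp [trace, mul_apply, Complex.sq_norm, Complex.normSq_apply]

/-- The Cauchy–Schwarz inequality for the Frobenius inner product. -/
theorem Matrix.norm_trace_mul_conjTranspose_sq_le {n : Type*} [Fintype n] (M K : Matrix n n ℂ) :
    ‖(M * Kᴴ).trace‖ ^ 2 ≤ (M * Mᴴ).trace.re * (K * Kᴴ).trace.re := by
  have h : ‖(M * Kᴴ).trace‖ ≤ ∑ x : n × n, ‖M x.1 x.2‖ * ‖K x.1 x.2‖ := by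
    simp only [trace, diag_apply, mul_apply, conjTranspose_apply, ← Fintype.sum_prod_type']
    refine (norm_sum_le _ _).trans_eq ?_
    simp
  rw [re_trace_mul_conjTranspose, re_trace_mul_conjTranspose]
  simp only [← Fintype.sum_prod_type']
  exact (pow_le_pow_left₀ (norm_nonneg _) h 2).trans (Finset.sum_mul_sq_le_sq_mul_sq _ _ _)

/-- The variance of a Hermitian matrix `A` in the state `P / tr P` is at most `tr (A * A) / 2`. -/
theorem Matrix.PosSemidef.re_trace_mul_sq_sub_sq_le {n : Type*} [Fintype n]
    {P A : Matrix n n ℂ} (hP : P.PosSemidef) (hA : A.IsHermitian) :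
    P.trace.re * (P * (A * A)).trace.re - (P * A).trace.re ^ 2
      ≤ P.trace.re ^ 2 * (A * A).trace.re / 2 := by
  classical
  set U : Matrix n n ℂ := (hA.eigenvectorUnitary : Matrix n n ℂ)
  set d : Matrix n n ℂ := diagonal fun i => (hA.eigenvalues i : ℂ) with hd
  have hUU : star U * U = 1 := Unitary.coe_star_mul_self hA.eigenvectorUnitary
  have hUU' : U * star U = 1 := Unitary.coe_mul_star_self hA.eigenvectorUnitary
  have hspec : A = U * d * star U := by
    conv_lhs => rw [hA.spectral_theorem, Unitary.conjStarAlgAut_apply]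
    rfl
  have hsq : A * A = U * (d * d) * star U := by
    conv_lhs => rw [hspec]
    simp only [Matrix.mul_assoc]
    rw [← Matrix.mul_assoc (star U) U, hUU, Matrix.one_mul]
  set Q := star U * P * U with hQ
  have hQpos : Q.PosSemidef := hP.conjTranspose_mul_mul_same U
  have htr (E : Matrix n n ℂ) : (P * (U * E * star U)).trace = (Q * E).trace := by
    rw [← Matrix.mul_assoc, trace_mul_comm, hQ]
    simp only [Matrix.mul_assoc]
  have hP1 : P.trace.re = ∑ i, (Q i i).re := by
    have h : P.trace = Q.trace := by
      rw [hQ, Matrix.mul_assoc, trace_mul_comm, Matrix.mul_assoc, hUU', Matrix.mul_one]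
    rw [h]; simp [trace]
  have hP2 : (P * A).trace.re = ∑ i, (Q i i).re * hA.eigenvalues i := by
    have h := htr d
    rw [← hspec] at h
    rw [h]; simp [trace, hd]
  have hP3 : (P * (A * A)).trace.re = ∑ i, (Q i i).re * hA.eigenvalues i ^ 2 := by
    rw [hsq, htr, hd, diagonal_mul_diagonal]
    simp [trace, sq]
  have hA2 : (A * A).trace.re = ∑ i, hA.eigenvalues i ^ 2 := by
    rw [hsq, trace_mul_comm, ← Matrix.mul_assoc, hUU, Matrix.one_mul]
    simp [trace, hd, sq]
  rw [hP1, hP2, hP3, hA2]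
  exact sum_weighted_sq_sub_sq_le _ _ fun i => (Complex.le_def.1 hQpos.diag_nonneg).1

/-- The Böttcher–Wenzel inequality in trace form, following Audenaert's variance argument. -/
theorem Matrix.re_trace_commutator_mul_conjTranspose_le {n : Type*} [Fintype n]
    (X Y : Matrix n n ℂ) :
    ((X * Y - Y * X) * (X * Y - Y * X)ᴴ).trace.re
      ≤ 2 * (X * Xᴴ).trace.re * (Y * Yᴴ).trace.re := by
  set t := (Y * Yᴴ).trace.re with ht
  rcases eq_or_ne t 0 with h0 | h0
  · have hY : Y = 0 := by
      ext i j
      rw [ht, re_trace_mul_conjTranspose] at h0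
      rw [Finset.sum_eq_zero_iff_of_nonneg fun _ _ => by positivity] at h0
      have h := h0 i (Finset.mem_univ i)
      rw [Finset.sum_eq_zero_iff_of_nonneg fun _ _ => by positivity] at h
      simpa using h j (Finset.mem_univ j)
    simp [hY, h0]
  have hpos : 0 < t := lt_of_le_of_ne
    (by rw [ht, re_trace_mul_conjTranspose]; positivity) h0.symm
  set P := Yᴴ * Y + Y * Yᴴ with hPdef
  have hP : P.PosSemidef :=
    (posSemidef_conjTranspose_mul_self Y).add (posSemidef_self_mul_conjTranspose Y)
  obtain ⟨A, B, hA, hB, hX⟩ : ∃ A B : Matrix n n ℂ, A.IsHermitian ∧ B.IsHermitian ∧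
      X = A + Complex.I • B := by
    refine ⟨(realPart X : Matrix n n ℂ), (imaginaryPart X : Matrix n n ℂ), (realPart X).2,
      (imaginaryPart X).2, (realPart_add_I_smul_imaginaryPart X).symm⟩
  have hXH : Xᴴ = A - Complex.I • B := by
    rw [hX, conjTranspose_add, conjTranspose_smul, hA.eq, hB.eq]
    simp [sub_eq_add_neg]
  have hPtr : P.trace.re = 2 * t := by
    rw [hPdef, trace_add, trace_mul_comm, Complex.add_re]; ring
  have hreal {C : Matrix n n ℂ} (hC : C.IsHermitian) : (P * C).trace.im = 0 := by
    rw [← Complex.conj_eq_iff_im]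
    change star _ = _
    rw [← trace_conjTranspose, conjTranspose_mul, hC.eq, hP.isHermitian.eq, trace_mul_comm]
  have hcross : ((X * Y - Y * X) * (X * Y - Y * X)ᴴ).trace.re
      + ((Xᴴ * Y + Y * Xᴴ) * (Xᴴ * Y + Y * Xᴴ)ᴴ).trace.re
      = (P * (Xᴴ * X + X * Xᴴ)).trace.re := by
    rw [← Complex.add_re, hPdef]
    congr 1
    simp only [conjTranspose_sub, conjTranspose_add, conjTranspose_mul, conjTranspose_conjTranspose,
      add_mul, mul_add, sub_mul, mul_sub, trace_add, trace_sub]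
    have e1 := trace_mul_comm X (Y * Yᴴ * Xᴴ)
    have e2 := trace_mul_comm X (Y * Xᴴ * Yᴴ)
    have e3 := trace_mul_comm (Y * X * Yᴴ) Xᴴ
    have e4 := trace_mul_comm (Y * X * Xᴴ) Yᴴ
    have e5 := trace_mul_comm Xᴴ (Y * Yᴴ * X)
    have e6 := trace_mul_comm (Y * Xᴴ * X) Yᴴ
    simp only [Matrix.mul_assoc] at e1 e2 e3 e4 e5 e6 ⊢
    rw [e1, e2, e3, e4, e5, e6]
    ring
  have hsum : Xᴴ * X + X * Xᴴ = (2 : ℂ) • (A * A + B * B) := by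
    rw [hXH, hX]
    simp only [add_mul, sub_mul, mul_add, mul_sub, smul_mul_assoc, mul_smul_comm]
    match_scalars <;> simp [one_add_one_eq_two]
  have hnorm : (X * Xᴴ).trace.re = (A * A).trace.re + (B * B).trace.re := by
    have h := congrArg (fun M : Matrix n n ℂ => M.trace.re) hsum
    simp [trace_mul_comm Xᴴ X] at h
    linarith
  have hcs := norm_trace_mul_conjTranspose_sq_le (Xᴴ * Y + Y * Xᴴ) Y
  have hinner : ‖((Xᴴ * Y + Y * Xᴴ) * Yᴴ).trace‖ ^ 2
      = (P * A).trace.re ^ 2 + (P * B).trace.re ^ 2 := by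
    have h : ((Xᴴ * Y + Y * Xᴴ) * Yᴴ).trace = (P * A).trace - Complex.I * (P * B).trace := by
      rw [← smul_eq_mul Complex.I, ← trace_smul, ← trace_sub, ← mul_smul_comm, ← mul_sub,
        ← hXH, hPdef, add_mul, add_mul, trace_add, trace_add, Matrix.mul_assoc Xᴴ, trace_mul_comm Xᴴ,
        Matrix.mul_assoc Y Xᴴ, trace_mul_comm Y, trace_mul_comm (Yᴴ * Y),
        ← Matrix.mul_assoc, add_comm]
    rw [h, Complex.sq_norm, Complex.normSq_apply]
    simp [hreal hA, hreal hB]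
    ring
  have hvA := hP.re_trace_mul_sq_sub_sq_le hA
  have hvB := hP.re_trace_mul_sq_sub_sq_le hB
  rw [hsum, mul_smul_comm, trace_smul, mul_add, trace_add, smul_eq_mul] at hcross
  simp only [Complex.mul_re, Complex.re_ofNat, Complex.im_ofNat, zero_mul, sub_zero,
    Complex.add_re (P * _).trace] at hcross
  rw [hinner] at hcs
  rw [hPtr] at hvA hvB
  rw [hnorm]
  refine le_of_mul_le_mul_left ?_ hpos
  linear_combination t * hcross + hcs + hvA + hvB

/-- Böttcher–Wenzel inequality: `‖[A,B]‖_F² ≤ 2 ‖A‖_F² ‖B‖_F²` for the commutator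
`[A,B] = AB − BA`. -/
theorem frobeniusNorm_commutator_sq_le {N : ℕ} (A B : Matrix (Fin N) (Fin N) ℂ) :
    frobeniusNorm (A * B - B * A) ^ 2 ≤ 2 * frobeniusNorm A ^ 2 * frobeniusNorm B ^ 2 := by
  have hsq (M : Matrix (Fin N) (Fin N) ℂ) : frobeniusNorm M ^ 2 = (M * Mᴴ).trace.re := by
    rw [frobeniusNorm, Real.sq_sqrt (by positivity), re_trace_mul_conjTranspose]
  simpa only [hsq] using re_trace_commutator_mul_conjTranspose_le A B
end

section
/- (Global error bound, Theorem 2) Let A ∈ ℂ^{N×N} be diagonalizable as A = Φ Λ Φ⁻¹ with Φ invertible and Λ diagonal whose diagonal entries λ₁, ..., λ_N satisfy max_k |λ_k| ≤ 1. Let m ≤ n be natural numbers, let ε ≥ 0, and let e^m, e^{m+1}, ..., e^n ∈ ℂ^N and τ^m, ..., τ^{n-1} ∈ ℂ^N satisfy the error recursion e^{k+1} = A e^k + τ^k with ‖τ^k‖₂ ≤ ε for all m ≤ k < n. Then ‖e^n‖₂ ≤ ‖Φ‖₂ ‖Φ⁻¹‖₂ [ ‖e^m‖₂ + (n − m) ε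 ]. -/
/-- The operator (spectral) norm of a square complex matrix. -/
noncomputable def opNorm {N : ℕ} (A : Matrix (Fin N) (Fin N) ℂ) : ℝ :=
  ‖Matrix.toEuclideanCLM (𝕜 := ℂ) A‖

open scoped Matrix.Norms.L2Operator in
/-- A diagonal matrix with entries of modulus at most one is a contraction. -/
theorem norm_toEuclideanCLM_le_one_of_isDiag {N : ℕ} {D : Matrix (Fin N) (Fin N) ℂ}
    (hD : D.IsDiag) (hD1 : ∀ i, ‖D i i‖ ≤ 1) :
    ‖Matrix.toEuclideanCLM (𝕜 := ℂ) D‖ ≤ 1 := by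
  rw [Matrix.l2_opNorm_toEuclideanCLM, ← hD.diagonal_diag, Matrix.l2_opNorm_diagonal]
  exact (pi_norm_le_iff_of_nonneg zero_le_one).2 hD1

/-- A contraction perturbed at each step by at most `δ` grows at most linearly. -/
theorem norm_le_add_mul_of_perturbed_contraction {E : Type*} [NormedAddCommGroup E]
    [NormedSpace ℂ E] {D : E →L[ℂ] E} (hD : ‖D‖ ≤ 1) {m n : ℕ} (hmn : m ≤ n) {δ : ℝ}
    {x r : ℕ → E} (hrec : ∀ k, m ≤ k → k < n → x (k + 1) = D (x k) + r k)
    (hr : ∀ k, m ≤ k → k < n → ‖r k‖ ≤ δ) :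
    ‖x n‖ ≤ ‖x m‖ + ((n : ℝ) - (m : ℝ)) * δ := by
  induction n, hmn using Nat.le_induction with
  | base => simp
  | succ n hmn ih =>
    have ih := ih (fun k h₁ h₂ => hrec k h₁ (by lia)) fun k h₁ h₂ => hr k h₁ (by lia)
    have hDx : ‖D (x n)‖ ≤ ‖x n‖ := by simpa using D.le_of_opNorm_le hD (x n)
    have hrn := hr n hmn n.lt_succ_self
    rw [hrec n hmn n.lt_succ_self]
    have hadd := norm_add_le (D (x n)) (r n)
    push_cast
    linarith

/-- Global error bound (Theorem 2): if `A = Φ Λ Φ⁻¹` with `Φ` invertible and `Λ` diagonal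
with `max_k |λ_k| ≤ 1`, and the errors satisfy the recursion `e^{k+1} = A e^k + τ^k` with
`‖τ^k‖₂ ≤ ε` for `m ≤ k < n`, then `‖e^n‖₂ ≤ ‖Φ‖₂ ‖Φ⁻¹‖₂ (‖e^m‖₂ + (n − m) ε)`. -/
theorem global_error_bound {N : ℕ} (A Φ Λ : Matrix (Fin N) (Fin N) ℂ)
    (hΦ : IsUnit Φ) (hΛ : Λ.IsDiag) (hΛ1 : ∀ i, ‖Λ i i‖ ≤ 1) (hA : A = Φ * Λ * Φ⁻¹)
    (m n : ℕ) (hmn : m ≤ n) (ε : ℝ) (hε : 0 ≤ ε)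
    (e τ : ℕ → EuclideanSpace ℂ (Fin N))
    (hrec : ∀ k, m ≤ k → k < n → e (k + 1) = Matrix.toEuclideanCLM (𝕜 := ℂ) A (e k) + τ k)
    (hτ : ∀ k, m ≤ k → k < n → ‖τ k‖ ≤ ε) :
    ‖e n‖ ≤ opNorm Φ * opNorm Φ⁻¹ * (‖e m‖ + ((n : ℝ) - (m : ℝ)) * ε) := by
  have hdet : IsUnit Φ.det := (Matrix.isUnit_iff_isUnit_det Φ).1 hΦ
  let P := Matrix.toEuclideanCLM (𝕜 := ℂ) Φ
  let Q := Matrix.toEuclideanCLM (𝕜 := ℂ) Φ⁻¹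
  let D := Matrix.toEuclideanCLM (𝕜 := ℂ) Λ
  have hPQ (x) : P (Q x) = x := by
    have h : P * Q = 1 := by
      simp only [P, Q, ← map_mul, Matrix.mul_nonsing_inv Φ hdet, map_one]
    exact congrArg (fun f => f x) h
  have hQA (x) : Q (Matrix.toEuclideanCLM (𝕜 := ℂ) A x) = D (Q x) := by
    have h : Q * Matrix.toEuclideanCLM (𝕜 := ℂ) A = D * Q := by
      simp only [Q, D, ← map_mul, hA, Matrix.mul_assoc,
        Matrix.nonsing_inv_mul_cancel_left _ _ hdet]
    exact congrArg (fun f => f x) h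
  have hQ : ‖Q (e n)‖ ≤ ‖Q (e m)‖ + ((n : ℝ) - (m : ℝ)) * (‖Q‖ * ε) := by
    refine norm_le_add_mul_of_perturbed_contraction (x := fun k => Q (e k))
      (r := fun k => Q (τ k)) (norm_toEuclideanCLM_le_one_of_isDiag hΛ hΛ1) hmn ?_ ?_
    · intro k h₁ h₂
      simp only [hrec k h₁ h₂, map_add, hQA, D]
    · exact fun k h₁ h₂ => Q.le_opNorm_of_le (hτ k h₁ h₂)
  calc ‖e n‖ = ‖P (Q (e n))‖ := by rw [hPQ]
    _ ≤ ‖P‖ * ‖Q (e n)‖ := P.le_opNorm _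
    _ ≤ ‖P‖ * (‖Q‖ * ‖e m‖ + ((n : ℝ) - (m : ℝ)) * (‖Q‖ * ε)) := by
      gcongr
      exact hQ.trans (by gcongr; exact Q.le_opNorm _)
    _ = opNorm Φ * opNorm Φ⁻¹ * (‖e m‖ + ((n : ℝ) - (m : ℝ)) * ε) := by
      simp only [opNorm, P, Q]
      ring
end
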